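/- arXiv:2509.16388 — 4 statements merged into one kernel-verified Lean document; each statement's English description precedes it below -/
import Mathlib

section
/- Let k be an algebraically closed field, Q a finite acyclic quiver, and χ an exceptional collection of finite-dimensional representations of Q. Then the directed graph G_χ has no directed cycles; that is, there do not exist m ≥ 2 and X_1, …, X_m ∈ χ with an edge X_1 → X_2, …, X_{m−1} → X_m, and X_m → X_1 in G_χ (equivalently, there is no cyclic chain of non-vanishing Hom- or Ext¹-spaces between distinct members of χ). -/
/-- A quiver, presented as a type of vertices together with a type of arrows
between any two vertices. -/
structure QuiverData : Type 1 where
  vertex : Type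
  hom : vertex → vertex → Type

/-- A quiver is acyclic if it admits no directed cycle of arrows. -/
def QuiverData.Acyclic (Q : QuiverData) : Prop :=
  ∀ v : Q.vertex, ¬ Relation.TransGen (fun a b : Q.vertex => Nonempty (Q.hom a b)) v v

/-- A `k`-linear representation of the quiver `Q`. -/
structure QRep (k : Type) [Field k] (Q : QuiverData) : Type 1 where
  space : Q.vertex → Type
  [instAddCommGroup : ∀ v, AddCommGroup (space v)]
  [instModule : ∀ v, Module k (space v)]
  map : ∀ {v w : Q.vertex}, Q.hom v w → (space v →ₗ[k] space w)

attribute [instance] QRep.instAddCommGroup QRep.instModule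

namespace QRep

variable {k : Type} [Field k] {Q : QuiverData}

/-- A representation is finite-dimensional if all its vertex spaces are. -/
def FinDim (X : QRep k Q) : Prop :=
  ∀ v : Q.vertex, FiniteDimensional k (X.space v)

/-- The space of morphisms of representations `X ⟶ Y`, as a submodule of the
product of the spaces of linear maps at each vertex. -/
def HomSubmodule (X Y : QRep k Q) :
    Submodule k (∀ v : Q.vertex, X.space v →ₗ[k] Y.space v) where
  carrier := {f | ∀ ⦃v w : Q.vertex⦄ (a : Q.hom v w), f w ∘ₗ X.map a = Y.map a ∘ₗ f v}
  add_mem' := by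
    intro f g hf hg v w a
    simp only [Pi.add_apply, LinearMap.add_comp, LinearMap.comp_add, hf a, hg a]
  zero_mem' := by
    intro v w a
    simp only [Pi.zero_apply, LinearMap.zero_comp, LinearMap.comp_zero]
  smul_mem' := by
    intro c f hf v w a
    simp only [Pi.smul_apply, LinearMap.smul_comp, LinearMap.comp_smul, hf a]

theorem mem_homSubmodule {X Y : QRep k Q}
    {f : ∀ v : Q.vertex, X.space v →ₗ[k] Y.space v} :
    f ∈ HomSubmodule X Y ↔
      ∀ ⦃v w : Q.vertex⦄ (a : Q.hom v w), f w ∘ₗ X.map a = Y.map a ∘ₗ f v :=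
  Iff.rfl

/-- The differential whose cokernel computes `Ext¹(X, Y)` for representations
of a quiver. -/
def extDiff (X Y : QRep k Q) :
    (∀ v : Q.vertex, X.space v →ₗ[k] Y.space v) →ₗ[k]
      (∀ v w : Q.vertex, Q.hom v w → (X.space v →ₗ[k] Y.space w)) where
  toFun f := fun v w a => Y.map a ∘ₗ f v - f w ∘ₗ X.map a
  map_add' f g := by
    funext v w a
    simp only [Pi.add_apply, LinearMap.comp_add, LinearMap.add_comp]
    abel
  map_smul' c f := by
    funext v w a
    simp only [Pi.smul_apply, LinearMap.comp_smul, LinearMap.smul_comp,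
      RingHom.id_apply, smul_sub]

/-- The first extension group `Ext¹(X, Y)` of two quiver representations,
realized as the cokernel of the standard differential. -/
abbrev Ext1 (X Y : QRep k Q) :=
  (∀ v w : Q.vertex, Q.hom v w → (X.space v →ₗ[k] Y.space w)) ⧸
    LinearMap.range (extDiff X Y)

/-- `Hom(X, Y) = 0`. -/
def HomIsZero (X Y : QRep k Q) : Prop :=
  HomSubmodule X Y = ⊥

/-- `Ext¹(X, Y) = 0`, i.e. the defining differential is surjective. -/
def Ext1IsZero (X Y : QRep k Q) : Prop :=
  LinearMap.range (extDiff X Y) = ⊤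

/-- Isomorphism of representations. -/
def Iso (X Y : QRep k Q) : Prop :=
  ∃ f ∈ HomSubmodule X Y, ∀ v : Q.vertex, Function.Bijective (f v)

/-- Indecomposability: `X` is nonzero and its only idempotent endomorphisms
are `0` and the identity. -/
def Indecomposable (X : QRep k Q) : Prop :=
  (∃ (v : Q.vertex) (x : X.space v), x ≠ 0) ∧
    ∀ f ∈ HomSubmodule X X,
      (∀ v : Q.vertex, f v ∘ₗ f v = f v) →
        f = 0 ∨ ∀ v : Q.vertex, f v = LinearMap.id

/-- An exceptional representation: indecomposable with no self-extensions. -/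
def ExceptionalRep (X : QRep k Q) : Prop :=
  Indecomposable X ∧ Ext1IsZero X X

/-- An exceptional sequence `(E 0, …, E (m-1))`. -/
def IsExceptionalSeq {m : ℕ} (E : Fin m → QRep k Q) : Prop :=
  (∀ i, ExceptionalRep (E i)) ∧
    ∀ i j : Fin m, j < i → HomIsZero (E i) (E j) ∧ Ext1IsZero (E i) (E j)

/-- An exceptional collection: a finite family of pairwise non-isomorphic
representations admitting at least one exceptional ordering. -/
def IsExceptionalCollection {m : ℕ} (X : Fin m → QRep k Q) : Prop :=
  (∀ i j : Fin m, i ≠ j → ¬ Iso (X i) (X j)) ∧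
    ∃ σ : Equiv.Perm (Fin m), IsExceptionalSeq (fun i => X (σ i))

/-- The edge relation of the directed graph `G_χ`: an edge `X i → X j`
whenever `i ≠ j` and `Hom(X i, X j) ≠ 0` or `Ext¹(X i, X j) ≠ 0`. -/
def GEdge {m : ℕ} (X : Fin m → QRep k Q) (i j : Fin m) : Prop :=
  i ≠ j ∧ (¬ HomIsZero (X i) (X j) ∨ ¬ Ext1IsZero (X i) (X j))

/-- The reachability relation `≤ₑ` on the members of a collection:
`i ≤ₑ j` iff `i = j` or there is a directed path from `i` to `j` in `G_χ`. -/
def ReachLE {m : ℕ} (X : Fin m → QRep k Q) : Fin m → Fin m → Prop :=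
  Relation.ReflTransGen (GEdge X)

/-- Along an edge of `G_χ`, the position in any exceptional ordering strictly increases. -/
theorem GEdge.position_lt {m : ℕ} {X : Fin m → QRep k Q} {σ : Equiv.Perm (Fin m)}
    (hσ : IsExceptionalSeq (fun i => X (σ i))) {i j : Fin m} (h : GEdge X i j) :
    σ.symm i < σ.symm j := by
  rcases lt_trichotomy (σ.symm i) (σ.symm j) with hlt | heq | hgt
  · exact hlt
  · exact absurd (σ.symm.injective heq) h.1
  · have hz := hσ.2 _ _ hgt
    simp only [Equiv.apply_symm_apply] at hz
    exact absurd hz (by simpa only [not_and_or] using h.2)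

end QRep



/-- For an exceptional collection `χ` of finite-dimensional
representations of a finite acyclic quiver over an algebraically closed field,
the directed graph `G_χ` has no directed cycles: there do not exist `m ≥ 2`
members `X_1, …, X_m` of `χ` with edges `X_1 → X_2, …, X_{m-1} → X_m` and
`X_m → X_1`. -/
theorem exceptionalCollection_no_directed_cycle
    (k : Type) [Field k] [IsAlgClosed k]
    (Q : QuiverData) [Finite Q.vertex] [∀ v w : Q.vertex, Finite (Q.hom v w)]
    (hQ : Q.Acyclic)
    {m : ℕ} (X : Fin m → QRep k Q)
    (hfd : ∀ i, (X i).FinDim)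
    (hX : QRep.IsExceptionalCollection X) :
    ¬ ∃ (c : ℕ) (f : Fin (c + 2) → Fin m),
        ∀ l : Fin (c + 2), QRep.GEdge X (f l) (f (l + 1)) := by
  rintro ⟨c, f, hf⟩
  obtain ⟨-, σ, hσ⟩ := hX
  obtain ⟨l, hl⟩ := Finite.exists_max (fun l => σ.symm (f l))
  exact ((hf l).position_lt hσ).not_ge (hl (l + 1))
end

section
/- Let k be an algebraically closed field, Q a finite acyclic quiver, and χ an exceptional collection of finite-dimensional representations of Q. Then the reachability relation ≤_e is a partial order on χ: it is reflexive, transitive, and antisymmetric. -/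
/-- The position of a member in an exceptional ordering is monotone along `≤ₑ`. -/
theorem QRep.ReachLE.symm_apply_le {k : Type} [Field k] {Q : QuiverData} {m : ℕ}
    {X : Fin m → QRep k Q} {σ : Equiv.Perm (Fin m)}
    (hσ : QRep.IsExceptionalSeq (fun i => X (σ i))) {i j : Fin m}
    (h : QRep.ReachLE X i j) : σ.symm i ≤ σ.symm j := by
  induction h with
  | refl => exact le_rfl
  | @tail b c _ hbc ih =>
    refine ih.trans (not_lt.mp fun hlt => ?_)
    have hz := hσ.2 _ _ hlt
    simp only [Equiv.apply_symm_apply] at hz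
    exact hbc.2.elim (fun h => h hz.1) (fun h => h hz.2)

/-- For an exceptional collection `χ` of finite-dimensional
representations of a finite acyclic quiver over an algebraically closed field,
the reachability relation `≤ₑ` is a partial order on `χ`: it is reflexive,
transitive and antisymmetric. -/
theorem reachLE_isPartialOrder
    (k : Type) [Field k] [IsAlgClosed k]
    (Q : QuiverData) [Finite Q.vertex] [∀ v w : Q.vertex, Finite (Q.hom v w)]
    (hQ : Q.Acyclic)
    {m : ℕ} (X : Fin m → QRep k Q)
    (hfd : ∀ i, (X i).FinDim)
    (hX : QRep.IsExceptionalCollection X) :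
    Reflexive (QRep.ReachLE X) ∧ Transitive (QRep.ReachLE X) ∧
      AntiSymmetric (QRep.ReachLE X) := by
  obtain ⟨-, σ, hσ⟩ := hX
  exact ⟨fun _ => .refl, fun _ _ _ => .trans, fun _ _ hij hji =>
    σ.symm.injective (le_antisymm (hij.symm_apply_le hσ) (hji.symm_apply_le hσ))⟩
end

section
/- Let k be an algebraically closed field, Q a finite acyclic quiver, χ an exceptional collection with n elements, and σ : {1,…,n} → χ a bijection. Then (σ(1), …, σ(n)) is an exceptional sequence if and only if σ realizes a linear extension of ≤_e, i.e., for all i, j ∈ {1,…,n}, σ(i) ≤_e σ(j) implies i ≤ j. -/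
/-- Let `χ` be an exceptional collection with `n` elements and
`σ` a bijection of `{1, …, n}` onto `χ`. Then `(σ 1, …, σ n)` is an exceptional
sequence if and only if `σ` realizes a linear extension of `≤ₑ`, i.e. for all
`i, j`, `σ i ≤ₑ σ j` implies `i ≤ j`. -/
theorem exceptionalSeq_iff_linear_extension
    (k : Type) [Field k] [IsAlgClosed k]
    (Q : QuiverData) [Finite Q.vertex] [∀ v w : Q.vertex, Finite (Q.hom v w)]
    (hQ : Q.Acyclic)
    {n : ℕ} (X : Fin n → QRep k Q)
    (hfd : ∀ i, (X i).FinDim)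
    (hX : QRep.IsExceptionalCollection X)
    (σ : Equiv.Perm (Fin n)) :
    QRep.IsExceptionalSeq (fun i => X (σ i)) ↔
      ∀ i j : Fin n, QRep.ReachLE X (σ i) (σ j) → i ≤ j := by
  constructor
  · intro hσ
    have hedge : ∀ i j : Fin n, QRep.GEdge X (σ i) (σ j) → i ≤ j := by
      rintro i j ⟨_, h⟩
      by_contra! hji
      obtain ⟨hHom, hExt⟩ := hσ.2 i j hji
      exact h.elim (· hHom) (· hExt)
    have hpath : ∀ i b : Fin n, QRep.ReachLE X (σ i) b → i ≤ σ.symm b := by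
      intro i b h
      induction h with
      | refl => simp
      | tail _ hbc ih => exact ih.trans (hedge _ _ (by simpa using hbc))
    intro i j h
    simpa using hpath i (σ j) h
  · intro hlin
    obtain ⟨-, τ, hτ, -⟩ := hX
    refine ⟨fun i => by simpa using hτ (τ.symm (σ i)), fun i j hji => ?_⟩
    by_contra hne
    refine (hlin i j (Relation.ReflTransGen.single ⟨?_, ?_⟩)).not_gt hji
    · exact σ.injective.ne hji.ne'
    · exact not_and_or.mp hne
end

section
/- Let k be an algebraically closed field, Q a finite acyclic quiver, and χ an exceptional collection with n elements. Then the number of bijections σ : {1,…,n} → χ such that (σ(1), …, σ(n)) is an exceptional sequence equals the number of linear extensions of the poset (χ, ≤_e), i.e., the number of total orders on χ that refine ≤_e. -/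
/-- A finite linearly ordered type is enumerated in increasing order by an initial segment
of the natural numbers. -/
theorem exists_equiv_fin_of_isLinearOrder {α : Type*} [Fintype α] {n : ℕ}
    (hn : Fintype.card α = n) (r : α → α → Prop) [IsLinearOrder α r] :
    ∃ e : Fin n ≃ α, ∀ a b, r a b ↔ e.symm a ≤ e.symm b := by
  classical
  let _ : LinearOrder α :=
    { le := r
      le_refl := refl_of r
      le_trans := fun _ _ _ => trans_of r
      le_antisymm := fun _ _ => antisymm_of r
      le_total := total_of r
      toDecidableLE := Classical.decRel r }
  let e : Fin n ≃o α := Fintype.orderIsoFinOfCardEq α hn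
  exact ⟨e.toEquiv, fun a b => (e.symm.le_iff_le (x := a) (y := b)).symm⟩

/-- An enumeration by `Fin n` is determined by the order it induces. -/
theorem equiv_fin_ext_of_le_iff {α : Type*} {n : ℕ} {e f : Fin n ≃ α}
    (h : ∀ a b, e.symm a ≤ e.symm b ↔ f.symm a ≤ f.symm b) : e = f := by
  let g : Fin n ≃o Fin n :=
    { toEquiv := e.trans f.symm
      map_rel_iff' := by
        intro a b
        simpa using (h (e a) (e b)).symm }
  have hg : g = OrderIso.refl (Fin n) := Subsingleton.elim _ _
  ext a
  have ha : f.symm (e a) = a := congrArg (fun i : Fin n ≃o Fin n => i a) hg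
  exact (f.symm_apply_eq.mp ha)

theorem isLinearOrder_of_equiv_fin {α : Type*} {n : ℕ} (e : Fin n ≃ α) :
    IsLinearOrder α (fun a b => e.symm a ≤ e.symm b) where
  refl _ := le_rfl
  trans _ _ _ := le_trans
  antisymm _ _ hab hba := e.symm.injective (le_antisymm hab hba)
  total _ _ := le_total _ _

namespace QRep

variable {k : Type} [Field k] {Q : QuiverData} {n : ℕ} {X : Fin n → QRep k Q}

theorem IsExceptionalCollection.exceptionalRep (hX : IsExceptionalCollection X) (i : Fin n) :
    ExceptionalRep (X i) := by
  obtain ⟨-, σ, hσ⟩ := hX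
  simpa using hσ.1 (σ.symm i)

/-- An ordering of exceptional representations is an exceptional sequence iff the total order
it induces refines the reachability relation. -/
theorem isExceptionalSeq_comp_perm_iff (hX : ∀ i, ExceptionalRep (X i))
    (σ : Equiv.Perm (Fin n)) :
    IsExceptionalSeq (fun i => X (σ i)) ↔
      ∀ i j, ReachLE X i j → σ.symm i ≤ σ.symm j := by
  refine ⟨fun h i j hij => ?_, fun h => ⟨fun i => hX _, fun i j hji => ?_⟩⟩
  · induction hij with
    | refl => exact le_rfl
    | @tail b c _ hbc ih =>
      refine ih.trans (le_of_not_gt fun hlt => ?_)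
      obtain ⟨hHom, hExt⟩ := h.2 _ _ hlt
      simp only [Equiv.apply_symm_apply] at hHom hExt
      exact hbc.2.elim (· hHom) (· hExt)
  · by_contra hne
    have hedge : GEdge X (σ i) (σ j) :=
      ⟨σ.injective.ne hji.ne', not_and_or.mp hne⟩
    have hle := h _ _ (Relation.ReflTransGen.single hedge)
    simp only [Equiv.symm_apply_apply] at hle
    exact hle.not_gt hji

end QRep

/-- For an exceptional collection `χ` with `n` elements, the
number of bijections `σ : {1, …, n} → χ` ordering `χ` into an exceptional
sequence equals the number of linear extensions of the poset `(χ, ≤ₑ)`, i.e.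
the number of total orders on `χ` refining `≤ₑ`. -/
theorem card_exceptional_orderings_eq_card_linear_extensions
    (k : Type) [Field k] [IsAlgClosed k]
    (Q : QuiverData) [Finite Q.vertex] [∀ v w : Q.vertex, Finite (Q.hom v w)]
    (hQ : Q.Acyclic)
    {n : ℕ} (X : Fin n → QRep k Q)
    (hfd : ∀ i, (X i).FinDim)
    (hX : QRep.IsExceptionalCollection X) :
    Nat.card {σ : Equiv.Perm (Fin n) // QRep.IsExceptionalSeq (fun i => X (σ i))} =
      Nat.card {r : Fin n → Fin n → Prop //
        IsLinearOrder (Fin n) r ∧ ∀ i j : Fin n, QRep.ReachLE X i j → r i j} := by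
  have hexc := hX.exceptionalRep
  refine Nat.card_eq_of_bijective
    (fun σ => ⟨fun a b => σ.1.symm a ≤ σ.1.symm b, isLinearOrder_of_equiv_fin σ.1,
      (QRep.isExceptionalSeq_comp_perm_iff hexc σ.1).mp σ.2⟩) ⟨?_, ?_⟩
  · intro σ τ h
    have hrel := congrArg Subtype.val h
    exact Subtype.ext (equiv_fin_ext_of_le_iff fun a b => iff_of_eq (congrFun₂ hrel a b))
  · rintro ⟨r, hr, hreach⟩
    obtain ⟨σ, hσ⟩ := exists_equiv_fin_of_isLinearOrder (Fintype.card_fin n) r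
    refine ⟨⟨σ, (QRep.isExceptionalSeq_comp_perm_iff hexc σ).mpr fun i j hij =>
      (hσ i j).mp (hreach i j hij)⟩, Subtype.ext ?_⟩
    funext a b
    exact propext (hσ a b).symm
end
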